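/- For every n and every stable tree T of the tree connection game with n agents, the cost of every agent in T is less than 8.62, and hence SC(T) ≤ 8.62 · n. Since the social optimum has social cost exactly n, the Price of Anarchy of the tree connection game is at most 8.62. -/

import Mathlib

open Function
open scoped ENNReal Classical

noncomputable section

namespace TCG

variable {n : ℕ}

/-- In-degree of node `v` in the network induced by profile `s` with root `r`:
the number of activated edges `(u, v)` with `u` an agent (a non-root node). -/
def indeg (r : Fin (n + 1)) (s : Fin (n + 1) → Fin (n + 1)) (v : Fin (n + 1)) : ℕ :=
  Nat.card {u : Fin (n + 1) | u ≠ r ∧ s u = v}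

/-- `|T(u)|`: the number of nodes having a directed path to `u` (including `u` itself). -/
def subtreeSize (s : Fin (n + 1) → Fin (n + 1)) (u : Fin (n + 1)) : ℕ :=
  Nat.card {w : Fin (n + 1) | ∃ k, s^[k] w = u}

/-- Cost of the agent at node `v` with respect to the root `r`:
the sum, over the edges `(u, u')` of the unique directed path from `v` to `r`,
of `indeg(u') / |T(u)|`; the cost is `∞` if no such path exists. -/
def cost (r : Fin (n + 1)) (s : Fin (n + 1) → Fin (n + 1)) (v : Fin (n + 1)) : ℝ≥0∞ :=
  if h : ∃ k, s^[k] v = r then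
    ∑ k ∈ Finset.range (Nat.find h),
      (indeg r s (s^[k + 1] v) : ℝ≥0∞) / (subtreeSize s (s^[k] v) : ℝ≥0∞)
  else ⊤

/-- A valid strategy profile: the root is absorbing (a formal convention encoding that the
root activates no edge), and every agent chooses a node different from herself. -/
def ValidProfile (r : Fin (n + 1)) (s : Fin (n + 1) → Fin (n + 1)) : Prop :=
  s r = r ∧ ∀ v, v ≠ r → s v ≠ v

/-- Pure Nash equilibrium (the induced network is *stable*): no agent can strictly
decrease her cost by unilaterally switching her activated edge to another node. -/
def IsStable (r : Fin (n + 1)) (s : Fin (n + 1) → Fin (n + 1)) : Prop :=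
  ValidProfile r s ∧
    ∀ v, v ≠ r → ∀ w, w ≠ v → cost r s v ≤ cost r (Function.update s v w) v

/-- Social cost: the sum of the costs of all agents (the non-root nodes). -/
def SC (s : Fin (n + 1) → Fin (n + 1)) : ℝ≥0∞ :=
  ∑ v ∈ Finset.univ.erase (0 : Fin (n + 1)), cost 0 s v

/-- Height of the induced network: the maximum length of a (leaf-to-)root path,
i.e. the least `k` such that every node arrives at the root after `k` steps. -/
def height (s : Fin (n + 1) → Fin (n + 1)) : ℕ :=
  sInf {k | ∀ v, s^[k] v = 0}

/-- Fairness Ratio: maximum agent cost divided by minimum agent cost. -/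
def FR (s : Fin (n + 1) → Fin (n + 1)) : ℝ≥0∞ :=
  (⨆ (v : Fin (n + 1)) (_ : v ≠ 0), cost 0 s v) /
    (⨅ (v : Fin (n + 1)) (_ : v ≠ 0), cost 0 s v)

theorem cost_root (r : Fin (n + 1)) (s : Fin (n + 1) → Fin (n + 1)) : cost r s r = 0 := by
  have h : ∃ k, s^[k] r = r := ⟨0, rfl⟩
  have h0 : Nat.find h = 0 := (Nat.find_eq_zero h).2 rfl
  simp [cost, h, h0]

/-- The cost of an agent is her share of her own edge plus the cost of her parent. -/
theorem cost_step {r : Fin (n + 1)} (s : Fin (n + 1) → Fin (n + 1)) {v : Fin (n + 1)}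
    (hv : v ≠ r) :
    cost r s v = (indeg r s (s v) : ℝ≥0∞) / (subtreeSize s v : ℝ≥0∞) + cost r s (s v) := by
  by_cases h : ∃ k, s^[k] (s v) = r
  · have h' : ∃ k, s^[k] v = r := h.imp' Nat.succ fun k hk => hk
    have hf : Nat.find h' = Nat.find h + 1 := Nat.find_comp_succ h' h hv
    simp only [cost, dif_pos h, dif_pos h', hf, Finset.sum_range_succ']
    rw [add_comm]
    rfl
  · have h' : ¬ ∃ k, s^[k] v = r := by
      rintro ⟨k, hk⟩
      cases k with
      | zero => exact hv hk
      | succ k => exact h ⟨k, hk⟩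
    simp [cost, dif_neg h, dif_neg h']

theorem subtreeSize_pos (s : Fin (n + 1) → Fin (n + 1)) (v : Fin (n + 1)) :
    0 < subtreeSize s v := by
  have : Nonempty {w : Fin (n + 1) | ∃ k, s^[k] w = v} := ⟨⟨v, 0, rfl⟩⟩
  exact Nat.card_pos

theorem cost_ne_top {r : Fin (n + 1)} {s : Fin (n + 1) → Fin (n + 1)} {v : Fin (n + 1)}
    (h : ∃ k, s^[k] v = r) : cost r s v ≠ ⊤ := by
  rw [cost, dif_pos h]
  refine ENNReal.sum_ne_top.2 fun k _ => ENNReal.div_ne_top (ENNReal.natCast_ne_top _) ?_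
  exact_mod_cast (subtreeSize_pos s _).ne'

theorem cost_le_of_reaches {r : Fin (n + 1)} {s : Fin (n + 1) → Fin (n + 1)} (hr : s r = r)
    (k : ℕ) (v : Fin (n + 1)) : cost r s (s^[k] v) ≤ cost r s v := by
  induction k generalizing v with
  | zero => exact le_rfl
  | succ k ih =>
    refine (ih (s v)).trans ?_
    by_cases hv : v = r
    · rw [hv, hr]
    · rw [cost_step s hv]
      exact le_add_self

theorem iterate_succ_ne_self {r : Fin (n + 1)} {s : Fin (n + 1) → Fin (n + 1)} (hr : s r = r)
    (htree : ∀ v, ∃ k, s^[k] v = r) {v : Fin (n + 1)} (hv : v ≠ r) (k : ℕ) :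
    s^[k + 1] v ≠ v := by
  intro h
  obtain ⟨j, hj⟩ := htree v
  have hp : s^[(k + 1) * j] v = v := (show IsPeriodicPt s (k + 1) v from h).mul_const j
  have he : (k + 1) * j = k * j + j := by ring
  rw [he, iterate_add_apply, hj, iterate_fixed hr] at hp
  exact hv hp.symm

/-- A node does not lie in the subtree of any of its children. -/
theorem not_reaches_child {r : Fin (n + 1)} {s : Fin (n + 1) → Fin (n + 1)} (hr : s r = r)
    (htree : ∀ v, ∃ k, s^[k] v = r) {u : Fin (n + 1)} (hu : u ≠ r) :
    ¬ ∃ k, s^[k] (s u) = u := by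
  rintro ⟨k, hk⟩
  exact iterate_succ_ne_self hr htree hu k hk

theorem not_reaches_sibling {r : Fin (n + 1)} {s : Fin (n + 1) → Fin (n + 1)} (hr : s r = r)
    (htree : ∀ v, ∃ k, s^[k] v = r) {u w : Fin (n + 1)} (hu : u ≠ r) (hs : s w = s u)
    (hne : w ≠ u) : ¬ ∃ k, s^[k] w = u := by
  rintro ⟨k, hk⟩
  cases k with
  | zero => exact hne hk
  | succ k =>
    rw [iterate_succ_apply, hs] at hk
    exact not_reaches_child hr htree hu ⟨k, hk⟩

theorem not_reaches_both_siblings {r : Fin (n + 1)} {s : Fin (n + 1) → Fin (n + 1)} (hr : s r = r)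
    (htree : ∀ v, ∃ k, s^[k] v = r) {u w z : Fin (n + 1)} (hu : u ≠ r) (hw : w ≠ r)
    (hs : s w = s u) (hne : w ≠ u) (hzu : ∃ k, s^[k] z = u) (hzw : ∃ k, s^[k] z = w) : False := by
  obtain ⟨i, hi⟩ := hzu
  obtain ⟨j, hj⟩ := hzw
  rcases le_total i j with h | h
  · obtain ⟨k, rfl⟩ := Nat.exists_eq_add_of_le' h
    rw [iterate_add_apply, hi] at hj
    exact not_reaches_sibling hr htree hw hs.symm hne.symm ⟨k, hj⟩
  · obtain ⟨k, rfl⟩ := Nat.exists_eq_add_of_le' h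
    rw [iterate_add_apply, hj] at hi
    exact not_reaches_sibling hr htree hu hs hne ⟨k, hi⟩

theorem update_iterate_of_not_reaches {s : Fin (n + 1) → Fin (n + 1)} {v y z : Fin (n + 1)}
    (hz : ¬ ∃ k, s^[k] z = v) (k : ℕ) : (update s v y)^[k] z = s^[k] z := by
  induction k with
  | zero => rfl
  | succ k ih =>
    rw [iterate_succ_apply', iterate_succ_apply', ih, update_of_ne]
    exact fun h => hz ⟨k, h⟩

theorem reaches_update_of_reaches {s : Fin (n + 1) → Fin (n + 1)} {v y w : Fin (n + 1)}
    (hw : ∃ k, s^[k] w = v) : ∃ k, (update s v y)^[k] w = v := by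
  obtain ⟨k, hk⟩ := hw
  induction k generalizing w with
  | zero => exact ⟨0, hk⟩
  | succ k ih =>
    by_cases h : w = v
    · exact ⟨0, h⟩
    · obtain ⟨j, hj⟩ := ih hk
      exact ⟨j + 1, by rw [iterate_succ_apply, update_of_ne h, hj]⟩

/-- Every node of the subtree of the deviating agent reaches the new parent and its ancestors. -/
theorem reaches_update_ancestor {s : Fin (n + 1) → Fin (n + 1)} {v y w : Fin (n + 1)}
    (hy : ¬ ∃ k, s^[k] y = v) (j : ℕ) (hw : ∃ k, s^[k] w = v) :
    ∃ k, (update s v y)^[k] w = s^[j] y := by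
  obtain ⟨k, hk⟩ := reaches_update_of_reaches (y := y) hw
  refine ⟨j + 1 + k, ?_⟩
  rw [iterate_add_apply, hk, iterate_succ_apply, update_self, update_iterate_of_not_reaches hy]

theorem subtree_subset_update_ancestor {s : Fin (n + 1) → Fin (n + 1)} {v y : Fin (n + 1)}
    (hy : ¬ ∃ k, s^[k] y = v) (j : ℕ) :
    {w | ∃ k, s^[k] w = s^[j] y} ⊆ {w | ∃ k, (update s v y)^[k] w = s^[j] y} := by
  intro w hw
  by_cases h : ∃ k, s^[k] w = v
  · exact reaches_update_ancestor hy j h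
  · obtain ⟨k, hk⟩ := hw
    exact ⟨k, by rw [update_iterate_of_not_reaches h, hk]⟩

theorem subtreeSize_le_update_ancestor {s : Fin (n + 1) → Fin (n + 1)} {v y : Fin (n + 1)}
    (hy : ¬ ∃ k, s^[k] y = v) (j : ℕ) :
    subtreeSize s (s^[j] y) ≤ subtreeSize (update s v y) (s^[j] y) :=
  Nat.card_mono (Set.toFinite _) (subtree_subset_update_ancestor hy j)

theorem subtreeSize_le_update_self (s : Fin (n + 1) → Fin (n + 1)) (v y : Fin (n + 1)) :
    subtreeSize s v ≤ subtreeSize (update s v y) v :=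
  Nat.card_mono (Set.toFinite _) fun _ => reaches_update_of_reaches

theorem indeg_update_le_succ (r : Fin (n + 1)) (s : Fin (n + 1) → Fin (n + 1))
    (v y : Fin (n + 1)) : indeg r (update s v y) y ≤ indeg r s y + 1 := by
  have hsub : {u | u ≠ r ∧ update s v y u = y} ⊆ insert v {u | u ≠ r ∧ s u = y} := by
    rintro u ⟨hu, hy⟩
    by_cases h : u = v
    · exact Or.inl h
    · exact Or.inr ⟨hu, by rwa [update_of_ne h] at hy⟩
  exact (Set.ncard_le_ncard hsub (Set.toFinite _)).trans (Set.ncard_insert_le _ _)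

theorem indeg_update_le {r : Fin (n + 1)} {s : Fin (n + 1) → Fin (n + 1)}
    {v y z : Fin (n + 1)} (hz : z ≠ y) : indeg r (update s v y) z ≤ indeg r s z := by
  refine Nat.card_mono (Set.toFinite _) ?_
  rintro u ⟨hu, huz⟩
  by_cases h : u = v
  · subst h
    rw [update_self] at huz
    exact absurd huz.symm hz
  · exact ⟨hu, by rwa [update_of_ne h] at huz⟩

theorem indeg_update_old_parent_lt {r : Fin (n + 1)} {s : Fin (n + 1) → Fin (n + 1)}
    {v y : Fin (n + 1)} (hv : v ≠ r) (hy : s v ≠ y) :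
    indeg r (update s v y) (s v) < indeg r s (s v) := by
  have hss : {u | u ≠ r ∧ update s v y u = s v} ⊂ {u | u ≠ r ∧ s u = s v} := by
    refine (Set.ssubset_iff_of_subset ?_).2 ⟨v, ⟨hv, rfl⟩, ?_⟩
    · rintro u ⟨hu, huz⟩
      by_cases h : u = v
      · exact ⟨hu, by rw [h]⟩
      · exact ⟨hu, by rwa [update_of_ne h] at huz⟩
    · rintro ⟨-, h⟩
      rw [update_self] at h
      exact hy h.symm
  exact Set.ncard_lt_ncard hss (Set.toFinite _)

/-- The new parent, and each of its ancestors, does not pay more after the deviation. -/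
theorem cost_update_ancestor_le {r : Fin (n + 1)} {s : Fin (n + 1) → Fin (n + 1)} (hr : s r = r)
    (htree : ∀ v, ∃ k, s^[k] v = r) {v y : Fin (n + 1)} (hy : ¬ ∃ k, s^[k] y = v) (j : ℕ) :
    cost r (update s v y) (s^[j] y) ≤ cost r s (s^[j] y) := by
  obtain ⟨i, hi⟩ := htree (s^[j] y)
  induction i generalizing j with
  | zero =>
    have hj : s^[j] y = r := hi
    rw [hj, cost_root]
    exact zero_le
  | succ i ih =>
    by_cases h : s^[j] y = r
    · rw [h, cost_root]
      exact zero_le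
    have hv : s^[j] y ≠ v := fun h => hy ⟨j, h⟩
    rw [cost_step _ h, cost_step _ h, update_of_ne hv]
    have hyr : y ≠ r := by
      rintro rfl
      exact h (iterate_fixed hr j)
    have hne : s (s^[j] y) ≠ y := by
      rw [← iterate_succ_apply' s]
      exact iterate_succ_ne_self hr htree hyr j
    have hi' := ih (j + 1)
    rw [iterate_succ_apply'] at hi'
    gcongr
    · exact indeg_update_le hne
    · exact subtreeSize_le_update_ancestor hy j
    · exact hi' hi

theorem cost_le_of_not_reaches {r : Fin (n + 1)} {s : Fin (n + 1) → Fin (n + 1)}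
    (hstable : IsStable r s) (htree : ∀ v, ∃ k, s^[k] v = r) {v y : Fin (n + 1)} (hv : v ≠ r)
    (hy : ¬ ∃ k, s^[k] y = v) :
    cost r s v ≤ ((indeg r s y + 1 : ℕ) : ℝ≥0∞) / (subtreeSize s v : ℝ≥0∞) + cost r s y := by
  refine (hstable.2 v hv y fun h => hy ⟨0, h⟩).trans ?_
  rw [cost_step _ hv, update_self]
  gcongr
  · exact indeg_update_le_succ r s v y
  · exact subtreeSize_le_update_self s v y
  · exact cost_update_ancestor_le hstable.1.1 htree hy 0

theorem subtreeSize_update_sibling {r : Fin (n + 1)} {s : Fin (n + 1) → Fin (n + 1)}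
    (hr : s r = r) (htree : ∀ v, ∃ k, s^[k] v = r) {u w : Fin (n + 1)} (hu : u ≠ r) (hw : w ≠ r)
    (hs : s w = s u) (hne : w ≠ u) :
    subtreeSize s u + subtreeSize s w ≤ subtreeSize (update s u w) w := by
  have hy := not_reaches_sibling hr htree hu hs hne
  have hdisj : Disjoint {z | ∃ k, s^[k] z = u} {z | ∃ k, s^[k] z = w} :=
    Set.disjoint_left.2 fun z hzu hzw =>
      not_reaches_both_siblings hr htree hu hw hs hne hzu hzw
  have hsub : {z | ∃ k, s^[k] z = u} ∪ {z | ∃ k, s^[k] z = w} ⊆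
      {z | ∃ k, (update s u w)^[k] z = w} :=
    Set.union_subset (fun z hz => reaches_update_ancestor hy 0 hz)
      (subtree_subset_update_ancestor hy 0)
  calc subtreeSize s u + subtreeSize s w
      = ({z | ∃ k, s^[k] z = u} ∪ {z | ∃ k, s^[k] z = w}).ncard :=
        (Set.ncard_union_eq hdisj (Set.toFinite _) (Set.toFinite _)).symm
    _ ≤ _ := Set.ncard_le_ncard hsub (Set.toFinite _)

/-- Stability against a deviation to a sibling. -/
theorem indeg_div_le_of_sibling {r : Fin (n + 1)} {s : Fin (n + 1) → Fin (n + 1)}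
    (hstable : IsStable r s) (htree : ∀ v, ∃ k, s^[k] v = r) {u w : Fin (n + 1)} (hu : u ≠ r)
    (hw : w ≠ r) (hs : s w = s u) (hne : w ≠ u) :
    (indeg r s (s u) : ℝ) / subtreeSize s u ≤
      ((indeg r s w : ℝ) + 1) / subtreeSize s u +
        ((indeg r s (s u) : ℝ) - 1) / (subtreeSize s u + subtreeSize s w) := by
  have hr := hstable.1.1
  have hy := not_reaches_sibling hr htree hu hs hne
  have hsw : s u ≠ w := by
    intro h
    exact hstable.1.2 w hw (hs.trans h)
  have hlt := indeg_update_old_parent_lt hu hsw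
  have hfin := cost_ne_top (htree (s u))
  have hsz : ∀ v, (subtreeSize s v : ℝ≥0∞) ≠ 0 := fun v => by
    exact_mod_cast (subtreeSize_pos s v).ne'
  have key : cost r s u ≤ ((indeg r s w + 1 : ℕ) : ℝ≥0∞) / (subtreeSize s u : ℝ≥0∞) +
      (((indeg r s (s u) - 1 : ℕ) : ℝ≥0∞) / ((subtreeSize s u + subtreeSize s w : ℕ) : ℝ≥0∞) +
        cost r s (s u)) := by
    refine (hstable.2 u hu w hne).trans ?_
    rw [cost_step _ hu, update_self, cost_step _ hw, update_of_ne hne, hs]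
    gcongr
    · exact indeg_update_le_succ r s u w
    · exact subtreeSize_le_update_self s u w
    · omega
    · exact subtreeSize_update_sibling hr htree hu hw hs hne
    · have := cost_update_ancestor_le hr htree hy 1
      rwa [iterate_one, hs] at this
  rw [cost_step _ hu, ← add_assoc, ENNReal.add_le_add_iff_right hfin] at key
  have hsum : ((subtreeSize s u + subtreeSize s w : ℕ) : ℝ≥0∞) ≠ 0 := by
    exact_mod_cast (Nat.add_pos_left (subtreeSize_pos s u) _).ne'
  have hreal := ENNReal.toReal_mono (ENNReal.add_ne_top.2
    ⟨ENNReal.div_ne_top (ENNReal.natCast_ne_top _) (hsz u),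
      ENNReal.div_ne_top (ENNReal.natCast_ne_top _) hsum⟩) key
  rw [ENNReal.toReal_add (ENNReal.div_ne_top (ENNReal.natCast_ne_top _) (hsz u))
    (ENNReal.div_ne_top (ENNReal.natCast_ne_top _) hsum)] at hreal
  simp only [ENNReal.toReal_div, ENNReal.toReal_natCast] at hreal
  rw [Nat.cast_sub (by omega)] at hreal
  push_cast at hreal
  exact hreal

/-- A child that is at least as large as some sibling has at least half of the remaining
in-degree of their parent. -/
theorem indeg_parent_le_of_sibling {r : Fin (n + 1)} {s : Fin (n + 1) → Fin (n + 1)}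
    (hstable : IsStable r s) (htree : ∀ v, ∃ k, s^[k] v = r) {u w : Fin (n + 1)} (hu : u ≠ r)
    (hw : w ≠ r) (hs : s w = s u) (hne : w ≠ u) (hle : subtreeSize s u ≤ subtreeSize s w) :
    indeg r s (s u) ≤ 2 * indeg r s w + 1 := by
  have key := indeg_div_le_of_sibling hstable htree hu hw hs hne
  have hd : (1 : ℝ) ≤ indeg r s (s u) := by
    have : Nonempty {z : Fin (n + 1) | z ≠ r ∧ s z = s u} := ⟨⟨u, hu, rfl⟩⟩
    exact_mod_cast (Nat.card_pos : 0 < Nat.card {z : Fin (n + 1) | z ≠ r ∧ s z = s u})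
  have hm : (0 : ℝ) < subtreeSize s u := by exact_mod_cast subtreeSize_pos s u
  have hle' : (subtreeSize s u : ℝ) ≤ subtreeSize s w := by exact_mod_cast hle
  have hhalf : ((indeg r s (s u) : ℝ) - 1) / (subtreeSize s u + subtreeSize s w) ≤
      ((indeg r s (s u) : ℝ) - 1) / 2 / subtreeSize s u := by
    rw [div_div]
    gcongr
    linarith
  have h := key.trans (add_le_add_right hhalf _)
  rw [← add_div, div_le_div_iff_of_pos_right hm] at h
  have : (indeg r s (s u) : ℝ) ≤ 2 * indeg r s w + 1 := by linarith
  exact_mod_cast this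

/-- The children of a node. -/
def children (r : Fin (n + 1)) (s : Fin (n + 1) → Fin (n + 1)) (x : Fin (n + 1)) :
    Finset (Fin (n + 1)) :=
  Finset.univ.filter fun u => u ≠ r ∧ s u = x

theorem card_children (r : Fin (n + 1)) (s : Fin (n + 1) → Fin (n + 1)) (x : Fin (n + 1)) :
    (children r s x).card = indeg r s x := by
  rw [indeg, Nat.card_eq_fintype_card, Fintype.card_subtype]
  rfl

theorem mem_children {r : Fin (n + 1)} {s : Fin (n + 1) → Fin (n + 1)} {x u : Fin (n + 1)} :
    u ∈ children r s x ↔ u ≠ r ∧ s u = x := by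
  simp [children]

theorem sum_children_lt {r : Fin (n + 1)} {s : Fin (n + 1) → Fin (n + 1)} (hr : s r = r)
    (htree : ∀ v, ∃ k, s^[k] v = r) (x : Fin (n + 1)) :
    ∑ u ∈ children r s x, subtreeSize s u < subtreeSize s x := by
  have hcard : ∀ v, subtreeSize s v = (Finset.univ.filter fun w => ∃ k, s^[k] w = v).card := by
    intro v
    rw [subtreeSize, Nat.card_eq_fintype_card, Fintype.card_subtype]
    rfl
  simp only [hcard]
  rw [← Finset.card_biUnion]
  · refine Finset.card_lt_card ((Finset.ssubset_iff_of_subset ?_).2 ⟨x, ?_, ?_⟩)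
    · intro w hw
      obtain ⟨u, hu, hwu⟩ := Finset.mem_biUnion.1 hw
      obtain ⟨k, hk⟩ := (Finset.mem_filter.1 hwu).2
      refine Finset.mem_filter.2 ⟨Finset.mem_univ _, k + 1, ?_⟩
      rw [iterate_succ_apply', hk, (mem_children.1 hu).2]
    · exact Finset.mem_filter.2 ⟨Finset.mem_univ _, 0, rfl⟩
    · intro hx
      obtain ⟨u, hu, hxu⟩ := Finset.mem_biUnion.1 hx
      obtain ⟨hur, rfl⟩ := mem_children.1 hu
      exact not_reaches_child hr htree hur (Finset.mem_filter.1 hxu).2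
  · intro u hu w hw hne
    obtain ⟨hur, hux⟩ := mem_children.1 hu
    obtain ⟨hwr, hwx⟩ := mem_children.1 hw
    refine Finset.disjoint_left.2 fun z hzu hzw => ?_
    exact not_reaches_both_siblings hr htree hur hwr (hwx.trans hux.symm) hne.symm
      (Finset.mem_filter.1 hzu).2 (Finset.mem_filter.1 hzw).2

/-- In a stable tree, a node of in-degree at least two has a child (one of second smallest size)
with at least half of the remaining in-degree and bounded size. -/
theorem exists_second_smallest_child {r : Fin (n + 1)} {s : Fin (n + 1) → Fin (n + 1)}
    (hstable : IsStable r s) (htree : ∀ v, ∃ k, s^[k] v = r) {x : Fin (n + 1)}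
    (hx : 2 ≤ indeg r s x) :
    ∃ z, z ≠ r ∧ s z = x ∧ indeg r s x ≤ 2 * indeg r s z + 1 ∧
      (indeg r s x - 1) * subtreeSize s z + 2 ≤ subtreeSize s x := by
  have hcard := card_children r s x
  obtain ⟨u, hu, humin⟩ := (children r s x).exists_min_image (subtreeSize s)
    (Finset.card_pos.1 (by omega))
  have hcard' : ((children r s x).erase u).card = indeg r s x - 1 := by
    rw [Finset.card_erase_of_mem hu, hcard]
  obtain ⟨z, hz, hzmin⟩ := ((children r s x).erase u).exists_min_image (subtreeSize s)
    (Finset.card_pos.1 (by omega))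
  obtain ⟨hzu, hzc⟩ := Finset.mem_erase.1 hz
  obtain ⟨hur, hux⟩ := mem_children.1 hu
  obtain ⟨hzr, hzx⟩ := mem_children.1 hzc
  refine ⟨z, hzr, hzx, ?_, ?_⟩
  · have := indeg_parent_le_of_sibling hstable htree hur hzr (hzx.trans hux.symm) hzu
      (humin z hzc)
    rwa [hux] at this
  · have hsum := sum_children_lt hstable.1.1 htree x
    rw [← Finset.add_sum_erase _ _ hu] at hsum
    have hmin : (indeg r s x - 1) * subtreeSize s z ≤
        ∑ w ∈ (children r s x).erase u, subtreeSize s w := by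
      rw [← hcard', ← smul_eq_mul]
      exact Finset.card_nsmul_le_sum _ _ _ hzmin
    have := subtreeSize_pos s u
    omega

theorem two_le_subtreeSize_of_indeg_pos {r : Fin (n + 1)} {s : Fin (n + 1) → Fin (n + 1)}
    (hr : s r = r) (htree : ∀ v, ∃ k, s^[k] v = r) {x : Fin (n + 1)} (hx : 0 < indeg r s x) :
    2 ≤ subtreeSize s x := by
  rw [← card_children, Finset.card_pos] at hx
  obtain ⟨u, hu⟩ := hx
  have h1 := sum_children_lt hr htree x
  have h2 := Finset.single_le_sum (f := subtreeSize s) (fun _ _ => Nat.zero_le _) hu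
  have h3 := subtreeSize_pos s u
  omega

theorem two_mul_indeg_le_subtreeSize {r : Fin (n + 1)} {s : Fin (n + 1) → Fin (n + 1)}
    (hstable : IsStable r s) (htree : ∀ v, ∃ k, s^[k] v = r) {x : Fin (n + 1)}
    (hx : 2 ≤ indeg r s x) : 2 * indeg r s x ≤ subtreeSize s x := by
  obtain ⟨z, -, -, hdeg, hsize⟩ := exists_second_smallest_child hstable htree hx
  have h2 := two_le_subtreeSize_of_indeg_pos hstable.1.1 htree (show 0 < indeg r s z by omega)
  have := Nat.mul_le_mul_left (indeg r s x - 1) h2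
  omega

theorem descent_inequality {d a t m : ℝ} (hd : 5 ≤ d) (ha : d ≤ 2 * a + 1) (hm : 0 < m)
    (ht : (d - 1) * m ≤ t) : d / m + 20 / 3 * (1 / 2 - a / m) ≤ 20 / 3 * (1 / 2 - d / t) := by
  have hpos : 0 < (d - 1) * m := mul_pos (by linarith) hm
  have h1 : d / t ≤ 5 / 4 / m := by
    rw [div_le_div_iff₀ (hpos.trans_le ht) hm]
    nlinarith
  have h2 : (d + 20 / 3 * (5 / 4)) / m ≤ 20 / 3 * a / m := by
    gcongr
    linarith
  have h3 : (d + 20 / 3 * (5 / 4)) / m = d / m + 20 / 3 * (5 / 4 / m) := by ring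
  have h4 : 20 / 3 * a / m = 20 / 3 * (a / m) := by ring
  linarith

/-- Below each node of in-degree at least two there is a node of in-degree at most four that
pays little for its path to that node. -/
theorem exists_cheap_node_of_small_indeg {r : Fin (n + 1)} {s : Fin (n + 1) → Fin (n + 1)}
    (hstable : IsStable r s) (htree : ∀ v, ∃ k, s^[k] v = r) (x : Fin (n + 1))
    (hx : 2 ≤ indeg r s x) :
    ∃ y, indeg r s y ≤ 4 ∧ (cost r s y).toReal ≤ (cost r s x).toReal +
      20 / 3 * (1 / 2 - (indeg r s x : ℝ) / subtreeSize s x) := by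
  induction hN : subtreeSize s x using Nat.strong_induction_on generalizing x with
  | _ N ih =>
    subst hN
    by_cases h4 : indeg r s x ≤ 4
    · refine ⟨x, h4, ?_⟩
      have h := two_mul_indeg_le_subtreeSize hstable htree hx
      have hpos : (0 : ℝ) < subtreeSize s x := by exact_mod_cast subtreeSize_pos s x
      have h' : 2 * (indeg r s x : ℝ) ≤ subtreeSize s x := by exact_mod_cast h
      have : (indeg r s x : ℝ) / subtreeSize s x ≤ 1 / 2 := by
        rw [div_le_div_iff₀ hpos two_pos]
        linarith
      linarith
    · obtain ⟨z, hzr, rfl, hdeg, hsize⟩ := exists_second_smallest_child hstable htree hx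
      have hlt : subtreeSize s z < subtreeSize s (s z) := by
        have := Nat.mul_le_mul_right (subtreeSize s z) (show 1 ≤ indeg r s (s z) - 1 by omega)
        omega
      obtain ⟨y, hy, hcost⟩ := ih _ hlt z (by omega) rfl
      refine ⟨y, hy, hcost.trans ?_⟩
      have hzpos : (subtreeSize s z : ℝ≥0∞) ≠ 0 := by exact_mod_cast (subtreeSize_pos s z).ne'
      rw [cost_step s hzr, ENNReal.toReal_add
        (ENNReal.div_ne_top (ENNReal.natCast_ne_top _) hzpos) (cost_ne_top (htree _)),
        ENNReal.toReal_div, ENNReal.toReal_natCast, ENNReal.toReal_natCast]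
      have hsize' : ((indeg r s (s z) : ℝ) - 1) * subtreeSize s z ≤ subtreeSize s (s z) := by
        have h : (((indeg r s (s z) - 1 : ℕ) : ℝ)) * subtreeSize s z ≤ subtreeSize s (s z) := by
          exact_mod_cast (Nat.le_add_right _ 2).trans hsize
        rwa [Nat.cast_sub (by omega), Nat.cast_one] at h
      have := descent_inequality (d := indeg r s (s z)) (a := indeg r s z)
        (by exact_mod_cast (show 5 ≤ indeg r s (s z) by omega)) (by exact_mod_cast hdeg)
        (by exact_mod_cast subtreeSize_pos s z) hsize'
      linarith

theorem exists_cheap_node {r : Fin (n + 1)} {s : Fin (n + 1) → Fin (n + 1)}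
    (hstable : IsStable r s) (htree : ∀ v, ∃ k, s^[k] v = r) :
    ∃ y, indeg r s y ≤ 4 ∧ (cost r s y).toReal ≤ 10 / 3 := by
  by_cases h : indeg r s r ≤ 4
  · exact ⟨r, h, by rw [cost_root]; norm_num⟩
  · obtain ⟨y, hy, hc⟩ := exists_cheap_node_of_small_indeg hstable htree r (by omega)
    refine ⟨y, hy, hc.trans ?_⟩
    rw [cost_root, ENNReal.toReal_zero]
    have : (0 : ℝ) ≤ (indeg r s r : ℝ) / subtreeSize s r := by positivity
    linarith

/-- Every agent of a stable tree pays at most `25 / 3`. -/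
theorem cost_le_of_isStable {r : Fin (n + 1)} {s : Fin (n + 1) → Fin (n + 1)}
    (hstable : IsStable r s) (htree : ∀ v, ∃ k, s^[k] v = r) {v : Fin (n + 1)} (hv : v ≠ r) :
    cost r s v ≤ ENNReal.ofReal (25 / 3) := by
  obtain ⟨y, hdeg, hcost⟩ := exists_cheap_node hstable htree
  have hy : cost r s y ≤ ENNReal.ofReal (10 / 3) :=
    (ENNReal.le_ofReal_iff_toReal_le (cost_ne_top (htree y)) (by norm_num)).2 hcost
  by_cases h : ∃ k, s^[k] y = v
  · obtain ⟨k, rfl⟩ := h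
    exact ((cost_le_of_reaches hstable.1.1 k y).trans hy).trans
      (ENNReal.ofReal_le_ofReal (by norm_num))
  · have hfrac : ((indeg r s y + 1 : ℕ) : ℝ≥0∞) / (subtreeSize s v : ℝ≥0∞) ≤
        ENNReal.ofReal 5 := by
      refine (ENNReal.div_le_of_le_mul ?_)
      have h1 : (1 : ℝ≥0∞) ≤ subtreeSize s v := by exact_mod_cast subtreeSize_pos s v
      have h5 : ((indeg r s y + 1 : ℕ) : ℝ≥0∞) ≤ ENNReal.ofReal 5 := by
        rw [ENNReal.ofReal_ofNat]
        exact_mod_cast Nat.succ_le_succ hdeg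
      calc ((indeg r s y + 1 : ℕ) : ℝ≥0∞) ≤ ENNReal.ofReal 5 * 1 := by rwa [mul_one]
        _ ≤ _ := by gcongr
    calc cost r s v ≤ _ := cost_le_of_not_reaches hstable htree hv h
      _ ≤ ENNReal.ofReal 5 + ENNReal.ofReal (10 / 3) := add_le_add hfrac hy
      _ = ENNReal.ofReal (25 / 3) := by
        rw [← ENNReal.ofReal_add (by norm_num) (by norm_num)]
        norm_num

/-- In every stable tree with `n` agents, the cost of every agent is
less than `8.62`; hence `SC(T) ≤ 8.62 · n`, and since the social optimum has social
cost exactly `n`, the Price of Anarchy is at most `8.62`. -/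
theorem price_of_anarchy_upper_bound {n : ℕ} (s : Fin (n + 1) → Fin (n + 1))
    (hstable : IsStable 0 s) (htree : ∀ v, ∃ k, s^[k] v = 0) :
    (∀ v : Fin (n + 1), v ≠ 0 → cost 0 s v < ENNReal.ofReal 8.62) ∧
    SC s ≤ ENNReal.ofReal 8.62 * (n : ℝ≥0∞) := by
  have hlt : ∀ v : Fin (n + 1), v ≠ 0 → cost 0 s v < ENNReal.ofReal 8.62 := fun v hv =>
    (cost_le_of_isStable hstable htree hv).trans_lt
      ((ENNReal.ofReal_lt_ofReal_iff (by norm_num)).2 (by norm_num))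
  refine ⟨hlt, ?_⟩
  calc SC s ≤ ∑ _v ∈ Finset.univ.erase (0 : Fin (n + 1)), ENNReal.ofReal 8.62 :=
        Finset.sum_le_sum fun v hv => (hlt v (Finset.ne_of_mem_erase hv)).le
    _ = ENNReal.ofReal 8.62 * (n : ℝ≥0∞) := by
      rw [Finset.sum_const, Finset.card_erase_of_mem (Finset.mem_univ _), Finset.card_univ,
        Fintype.card_fin, Nat.add_sub_cancel, nsmul_eq_mul, mul_comm]

end TCG
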